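/- The vector space ĝ = (𝔤 ⊗_ℂ R) ⊕ (Ω_R/dR) with bracket defined by [x⊗f + ω, y⊗g + ω'] = [x,y]⊗fg + (x,y)\overline{f\, dg} is a Lie algebra over ℂ, and on the indicated elements the bracket is given explicitly by: [x⊗t^i, y⊗t^j] = [x,y]⊗t^{i+j} + j δ_{i+j,0} (x,y) ω₀; [x⊗t^{i}u, y⊗t^{j}u] = [x,y]⊗t^{i+j}p(t) + Σ_{k=1}^{r+1} (j + k/2) a_k δ_{i+j,−k} (x,y) ω₀; and [x⊗t^{i}u, y⊗t^{j}] = [x,y]⊗t^{i+j}u + j (x,y) ψ_{ij}, where ψ_{ij} = Σ_{k=1}^{r} P_{i+j−1,−k} ω_k if i + j ≥ −r + 1 and ψ_{ij} = Σ_{k=1}^{r} Q_{−i−j+1,−k} ω_k if i + j < −r + 1. -/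

import Mathlib

open scoped BigOperators

noncomputable section

/-- The hyperelliptic ring `R = ℂ[t,t⁻¹,u : u² = p(t)]`, realized as
`ℂ[t,t⁻¹][X]/(X² - p)`. -/
abbrev HypRing (p : LaurentPolynomial ℂ) : Type :=
  AdjoinRoot (Polynomial.X ^ 2 - Polynomial.C p)

/-- The element `t^i` of `R`, for `i : ℤ`. -/
noncomputable def tP (p : LaurentPolynomial ℂ) (i : ℤ) : HypRing p :=
  AdjoinRoot.of _ (LaurentPolynomial.T i)

/-- The element `u` of `R`. -/
noncomputable def uE (p : LaurentPolynomial ℂ) : HypRing p := AdjoinRoot.root _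

/-- The module of Kähler differentials `Ω_R` of `R` over `ℂ`. -/
abbrev HypOmega (p : LaurentPolynomial ℂ) := KaehlerDifferential ℂ (HypRing p)

/-- The subspace `dR ⊆ Ω_R` of exact differentials. -/
noncomputable def dSub (p : LaurentPolynomial ℂ) : Submodule ℂ (HypOmega p) :=
  LinearMap.range (KaehlerDifferential.D ℂ (HypRing p)).toLinearMap

/-- The quotient `Ω_R/dR`. -/
abbrev HypCenter (p : LaurentPolynomial ℂ) := HypOmega p ⧸ dSub p

/-- The class `\overline{f dg}` of `f dg` in `Ω_R/dR`. -/
noncomputable def cls (p : LaurentPolynomial ℂ) (f g : HypRing p) : HypCenter p :=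
  Submodule.Quotient.mk (f • (KaehlerDifferential.D ℂ (HypRing p) g))

/-- `ω₀ = \overline{t⁻¹ dt}` and `ω_k = \overline{t^{-k} u dt}` for `k ≥ 1`. -/
noncomputable def om (p : LaurentPolynomial ℂ) (k : ℕ) : HypCenter p :=
  if k = 0 then cls p (tP p (-1)) (tP p 1)
  else cls p (tP p (-(k : ℤ)) * uE p) (tP p 1)

section Differentials

variable (p : LaurentPolynomial ℂ)

/-- The bilinear map `(f, g) ↦ \overline{f dg}`. -/
def clsBilin : HypRing p →ₗ[ℂ] HypRing p →ₗ[ℂ] HypCenter p :=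
  LinearMap.mk₂ ℂ (cls p)
    (fun f f' g => by simp only [cls, add_smul, Submodule.Quotient.mk_add])
    (fun c f g => by simp only [cls, smul_assoc, Submodule.Quotient.mk_smul])
    (fun f g g' => by simp only [cls, map_add, smul_add, Submodule.Quotient.mk_add])
    (fun c f g => by
      simp only [cls, Derivation.map_smul, smul_comm f c, Submodule.Quotient.mk_smul])

theorem clsBilin_apply (f g : HypRing p) : clsBilin p f g = cls p f g := rfl

theorem mk_D_eq_zero (f : HypRing p) :
    (Submodule.Quotient.mk (KaehlerDifferential.D ℂ (HypRing p) f) : HypCenter p) = 0 :=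
  (Submodule.Quotient.mk_eq_zero _).2 ⟨f, rfl⟩

theorem cls_add_cls_swap (f g : HypRing p) : cls p f g + cls p g f = 0 := by
  rw [cls, cls, ← Submodule.Quotient.mk_add, ← Derivation.leibniz, mk_D_eq_zero]

theorem cls_mul_right (f g h : HypRing p) :
    cls p f (g * h) = cls p (f * g) h + cls p (f * h) g := by
  simp only [cls, Derivation.leibniz, smul_add, smul_smul, Submodule.Quotient.mk_add]

theorem cls_one_left (f : HypRing p) : cls p 1 f = 0 := by
  rw [cls, one_smul, mk_D_eq_zero]

theorem cls_mul_cyclic (f g h : HypRing p) :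
    cls p (f * g) h + cls p (g * h) f + cls p (h * f) g = 0 := by
  have h₁ := cls_add_cls_swap p (g * h) f
  rw [cls_mul_right, mul_comm f h] at h₁
  rw [← h₁]
  abel

theorem tP_add (i j : ℤ) : tP p (i + j) = tP p i * tP p j := by
  simp only [tP, LaurentPolynomial.T_add, map_mul]

theorem tP_zero : tP p 0 = 1 := by
  simp only [tP, LaurentPolynomial.T_zero, map_one]

theorem uE_mul_uE : uE p * uE p = AdjoinRoot.of _ p := by
  have h := AdjoinRoot.eval₂_root (Polynomial.X ^ 2 - Polynomial.C p)
  rw [Polynomial.eval₂_sub, Polynomial.eval₂_pow, Polynomial.eval₂_X, Polynomial.eval₂_C,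
    sub_eq_zero] at h
  rw [← h]
  exact (pow_two _).symm

theorem D_tP (j : ℤ) :
    KaehlerDifferential.D ℂ (HypRing p) (tP p j) =
      (j : ℂ) • tP p (j - 1) • KaehlerDifferential.D ℂ (HypRing p) (tP p 1) := by
  have step (j : ℤ) : KaehlerDifferential.D ℂ (HypRing p) (tP p (j + 1)) =
      tP p j • KaehlerDifferential.D ℂ (HypRing p) (tP p 1) +
        tP p 1 • KaehlerDifferential.D ℂ (HypRing p) (tP p j) := by
    rw [tP_add, Derivation.leibniz]
  induction j using Int.induction_on with
  | zero => rw [tP_zero, Derivation.map_one_eq_zero, Int.cast_zero, zero_smul]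
  | succ n ih =>
    rw [step, ih, smul_comm (tP p 1) ((n : ℤ) : ℂ), smul_smul, ← tP_add,
      show (1 : ℤ) + (n - 1) = n by ring, show (n : ℤ) + 1 - 1 = n by ring]
    push_cast
    rw [add_smul, one_smul, add_comm]
  | pred n ih =>
    have h := step (-n - 1)
    rw [sub_add_cancel, ih] at h
    have h' := congrArg (fun ω => tP p (-1) • ω) h
    simp only [smul_add, smul_smul, ← tP_add] at h'
    rw [smul_comm (tP p (-1)) ((-n : ℤ) : ℂ), smul_smul, ← tP_add,
      show (-1 : ℤ) + 1 = 0 by ring, tP_zero, one_smul,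
      show (-1 : ℤ) + (-n - 1) = -n - 1 - 1 by ring] at h'
    rw [← sub_eq_iff_eq_add'] at h'
    rw [← h']
    push_cast
    rw [sub_smul, one_smul]

/-- `f d(t^j) = j f t^{j-1} dt`. -/
theorem cls_tP (f : HypRing p) (j : ℤ) :
    cls p f (tP p j) = (j : ℂ) • cls p (f * tP p (j - 1)) (tP p 1) := by
  rw [cls, D_tP, smul_comm f (j : ℂ), smul_smul, Submodule.Quotient.mk_smul, cls]

theorem cls_tP_dt_eq_zero {n : ℤ} (hn : n ≠ 0) : cls p (tP p (n - 1)) (tP p 1) = 0 := by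
  have h := cls_tP p 1 n
  rw [cls_one_left, one_mul] at h
  exact (smul_eq_zero.1 h.symm).resolve_left (by exact_mod_cast hn)

/-- The class `\overline{t^n u dt}`. -/
def clsU (n : ℤ) : HypCenter p := cls p (tP p n * uE p) (tP p 1)

theorem cls_tP_mul_uE_tP (i j : ℤ) :
    cls p (tP p i * uE p) (tP p j) = (j : ℂ) • clsU p (i + j - 1) := by
  rw [cls_tP, clsU, mul_right_comm, ← tP_add, add_sub_assoc]

theorem two_smul_cls_mul_uE_uE (f : HypRing p) :
    (2 : ℂ) • cls p (f * uE p) (uE p) = cls p f (AdjoinRoot.of _ p) := by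
  rw [← uE_mul_uE, cls_mul_right, two_smul]

/-- Exactness of `d(f u³)`. -/
theorem two_smul_cls_add_three_smul_cls (f : HypRing p) :
    (2 : ℂ) • cls p (uE p * AdjoinRoot.of _ p) f +
      (3 : ℂ) • cls p (f * uE p) (AdjoinRoot.of _ p) = 0 := by
  have h₁ := cls_add_cls_swap p f (uE p * AdjoinRoot.of _ p)
  have h₂ := two_smul_cls_mul_uE_uE p (f * uE p)
  rw [mul_assoc, uE_mul_uE] at h₂
  rw [cls_mul_right, ← h₂] at h₁
  rw [← h₂, eq_neg_of_add_eq_zero_right h₁]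
  module

section Expansion

variable {p} {r : ℕ} {a : ℕ → ℂ}

theorem of_eq_sum_smul_tP
    (hpa : p = ∑ i ∈ Finset.Icc 1 (r + 1),
      LaurentPolynomial.C (a i) * LaurentPolynomial.T (i : ℤ)) :
    (AdjoinRoot.of _ p : HypRing p) = ∑ k ∈ Finset.Icc 1 (r + 1), a k • tP p k := by
  conv_lhs => arg 2; rw [hpa]
  rw [map_sum]
  refine Finset.sum_congr rfl fun k _ => ?_
  rw [map_mul, Algebra.smul_def]
  rfl

theorem cls_of_right
    (hpa : p = ∑ i ∈ Finset.Icc 1 (r + 1),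
      LaurentPolynomial.C (a i) * LaurentPolynomial.T (i : ℤ))
    (f : HypRing p) :
    cls p f (AdjoinRoot.of _ p) = ∑ k ∈ Finset.Icc 1 (r + 1), a k • cls p f (tP p k) := by
  rw [of_eq_sum_smul_tP hpa]
  simp only [← clsBilin_apply, map_sum, map_smul]

theorem cls_mul_of_left
    (hpa : p = ∑ i ∈ Finset.Icc 1 (r + 1),
      LaurentPolynomial.C (a i) * LaurentPolynomial.T (i : ℤ))
    (f g : HypRing p) :
    cls p (f * AdjoinRoot.of _ p) g =
      ∑ k ∈ Finset.Icc 1 (r + 1), a k • cls p (f * tP p k) g := by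
  rw [of_eq_sum_smul_tP hpa, Finset.mul_sum]
  simp only [← clsBilin_apply, map_sum, LinearMap.sum_apply, mul_smul_comm, map_smul,
    LinearMap.smul_apply]

theorem sum_smul_clsU_eq_zero
    (hpa : p = ∑ i ∈ Finset.Icc 1 (r + 1),
      LaurentPolynomial.C (a i) * LaurentPolynomial.T (i : ℤ))
    (n : ℤ) :
    ∑ k ∈ Finset.Icc 1 (r + 1),
      (((2 * n + 3 * k : ℤ) : ℂ) * a k) • clsU p (n + k - 1) = 0 := by
  rw [← two_smul_cls_add_three_smul_cls p (tP p n), cls_mul_of_left hpa, cls_of_right hpa,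
    Finset.smul_sum, Finset.smul_sum, ← Finset.sum_add_distrib]
  refine Finset.sum_congr rfl fun k _ => ?_
  rw [mul_comm (uE p), cls_tP_mul_uE_tP, cls_tP_mul_uE_tP, add_comm (k : ℤ) n]
  push_cast
  module

theorem cls_tP_mul_uE_tP_mul_uE
    (hpa : p = ∑ i ∈ Finset.Icc 1 (r + 1),
      LaurentPolynomial.C (a i) * LaurentPolynomial.T (i : ℤ))
    (i j : ℤ) :
    cls p (tP p i * uE p) (tP p j * uE p) =
      (∑ k ∈ Finset.Icc 1 (r + 1),
        if i + j = -(k : ℤ) then ((j : ℂ) + (k : ℂ) / 2) * a k else 0) • om p 0 := by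
  have h : (2 : ℂ) • cls p (tP p i * uE p) (tP p j * uE p) =
      cls p (tP p (i + j)) (AdjoinRoot.of _ p) +
        (2 : ℂ) • cls p (tP p i * AdjoinRoot.of _ p) (tP p j) := by
    rw [cls_mul_right, mul_right_comm, ← tP_add, smul_add, two_smul_cls_mul_uE_uE, mul_assoc,
      uE_mul_uE]
  refine smul_right_injective _ (two_ne_zero (α := ℂ)) ?_
  dsimp only
  rw [h, cls_of_right hpa, cls_mul_of_left hpa, Finset.smul_sum, ← Finset.sum_add_distrib,
    Finset.sum_smul, Finset.smul_sum]
  refine Finset.sum_congr rfl fun k _ => ?_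
  rw [cls_tP, cls_tP _ _ j, ← tP_add, ← tP_add, ← tP_add,
    show i + k + (j - 1) = i + j + k - 1 by ring, show i + j + (k - 1) = i + j + k - 1 by ring]
  split_ifs with hk
  · rw [show i + j + k - 1 = -1 by omega, om, if_pos rfl]
    push_cast
    module
  · rw [cls_tP_dt_eq_zero p (n := i + j + k) (by omega)]
    simp

end Expansion

theorem om_eq_clsU {k : ℕ} (hk : k ≠ 0) : om p k = clsU p (-k) := by
  rw [om, if_neg hk, clsU]

theorem cls_tP_tP (i j : ℤ) :
    cls p (tP p i) (tP p j) = (if i + j = 0 then (j : ℂ) else 0) • om p 0 := by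
  rw [cls_tP, ← tP_add, ← add_sub_assoc]
  split_ifs with h
  · rw [h, om, if_pos rfl, zero_sub]
  · rw [cls_tP_dt_eq_zero p h, smul_zero, zero_smul]

end Differentials

section Recursions

variable {p : LaurentPolynomial ℂ} {r : ℕ} {a : ℕ → ℂ}

theorem coeff_sum_C_mul_X_pow {k : ℕ} (hk : k ∈ Finset.Icc 1 (r + 1)) :
    (∑ i ∈ Finset.Icc 1 (r + 1), Polynomial.C (a i) * Polynomial.X ^ i).coeff k = a k := by
  simp only [Polynomial.finsetSum_coeff, Polynomial.coeff_C_mul_X_pow]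
  rw [Finset.sum_ite_eq, if_pos hk]

theorem X_mul_prod_eq_sum {α : Fin r → ℂ}
    (h : LaurentPolynomial.T 1 * ∏ i : Fin r, (LaurentPolynomial.T 1 - LaurentPolynomial.C (α i)) =
      ∑ i ∈ Finset.Icc 1 (r + 1), LaurentPolynomial.C (a i) * LaurentPolynomial.T (i : ℤ)) :
    Polynomial.X * ∏ i : Fin r, (Polynomial.X - Polynomial.C (α i)) =
      ∑ i ∈ Finset.Icc 1 (r + 1), Polynomial.C (a i) * Polynomial.X ^ i := by
  apply Polynomial.toLaurent_injective
  simpa only [map_mul, map_prod, map_sub, map_sum, Polynomial.toLaurent_X, Polynomial.toLaurent_C,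
    Polynomial.toLaurent_X_pow] using h

theorem leading_eq_one {α : Fin r → ℂ}
    (h : LaurentPolynomial.T 1 * ∏ i : Fin r, (LaurentPolynomial.T 1 - LaurentPolynomial.C (α i)) =
      ∑ i ∈ Finset.Icc 1 (r + 1), LaurentPolynomial.C (a i) * LaurentPolynomial.T (i : ℤ)) :
    a (r + 1) = 1 := by
  have hm := Polynomial.monic_prod_of_monic Finset.univ
    (fun i : Fin r => Polynomial.X - Polynomial.C (α i)) fun i _ => Polynomial.monic_X_sub_C (α i)
  have hd : (∏ i : Fin r, (Polynomial.X - Polynomial.C (α i))).natDegree = r := by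
    simp [Polynomial.natDegree_prod_of_monic _ _ fun i _ => Polynomial.monic_X_sub_C (α i)]
  rw [← coeff_sum_C_mul_X_pow (a := a) (r := r) (k := r + 1) (by simp), ← X_mul_prod_eq_sum h,
    Polynomial.coeff_X_mul]
  rw [Polynomial.Monic, Polynomial.leadingCoeff, hd] at hm
  exact hm

theorem linear_coeff_ne_zero {α : Fin r → ℂ} (hα : ∀ i, α i ≠ 0)
    (h : LaurentPolynomial.T 1 * ∏ i : Fin r, (LaurentPolynomial.T 1 - LaurentPolynomial.C (α i)) =
      ∑ i ∈ Finset.Icc 1 (r + 1), LaurentPolynomial.C (a i) * LaurentPolynomial.T (i : ℤ)) :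
    a 1 ≠ 0 := by
  rw [← coeff_sum_C_mul_X_pow (a := a) (r := r) (k := 1) (by simp), ← X_mul_prod_eq_sum h,
    Polynomial.coeff_X_mul, Polynomial.coeff_zero_eq_eval_zero, Polynomial.eval_prod]
  exact Finset.prod_ne_zero_iff.2 fun i _ => by simpa using hα i

theorem clsU_eq_sum_P
    (hpa : p = ∑ i ∈ Finset.Icc 1 (r + 1),
      LaurentPolynomial.C (a i) * LaurentPolynomial.T (i : ℤ))
    (ha : a (r + 1) = 1) {P : ℤ → ℤ → ℂ}
    (hPinit : ∀ l i : ℤ, -(r : ℤ) ≤ l → l ≤ -1 → -(r : ℤ) ≤ i → i ≤ -1 →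
      P l i = if l = i then 1 else 0)
    (hPrec : ∀ k : ℤ, 0 ≤ k → ∀ i : ℤ,
      ((2 * k + (r : ℤ) + 3 : ℤ) : ℂ) * P k i
        = -∑ j ∈ Finset.Icc 1 r,
            ((3 * (j : ℤ) + 2 * k - 2 * (r : ℤ) : ℤ) : ℂ) * a j * P (k - r + j - 1) i)
    (n : ℤ) (hn : -(r : ℤ) ≤ n) :
    clsU p n = ∑ k ∈ Finset.Icc 1 r, P n (-(k : ℤ)) • om p k := by
  induction n using Int.strongRec (m := 0) with
  | lt n hn0 =>
    rw [Finset.sum_eq_single_of_mem n.natAbs (by simp; omega)]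
    · rw [hPinit _ _ hn (by omega) (by omega) (by omega), if_pos (by omega), one_smul,
        om_eq_clsU p (by omega)]
      congr 1
      omega
    · intro k hk hne
      rw [Finset.mem_Icc] at hk
      rw [hPinit _ _ hn (by omega) (by omega) (by omega), if_neg (by omega), zero_smul]
  | ge n hn0 ih =>
    have hc : ((2 * n + (r : ℤ) + 3 : ℤ) : ℂ) ≠ 0 := by
      rw [Int.cast_ne_zero]; omega
    refine smul_right_injective _ hc ?_
    dsimp only
    have h := sum_smul_clsU_eq_zero hpa (n - r)
    rw [Finset.sum_Icc_succ_top (by omega), ha, mul_one, ← eq_neg_iff_add_eq_zero, eq_comm,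
      neg_eq_iff_eq_neg, show n - r + (r + 1 : ℕ) - 1 = n by push_cast; ring,
      show 2 * (n - r) + 3 * ((r + 1 : ℕ) : ℤ) = 2 * n + r + 3 by push_cast; ring] at h
    simp_rw [h, Finset.smul_sum, smul_smul, hPrec n hn0, neg_smul, Finset.sum_smul]
    rw [Finset.sum_neg_distrib, Finset.sum_comm]
    refine congrArg Neg.neg (Finset.sum_congr rfl fun k hk => ?_)
    rw [Finset.mem_Icc] at hk
    rw [ih _ (by omega) (by omega), Finset.smul_sum]
    refine Finset.sum_congr rfl fun l _ => ?_
    rw [smul_smul, show 2 * (n - r) + 3 * (k : ℤ) = 3 * k + 2 * n - 2 * r by ring]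

theorem clsU_eq_sum_Q
    (hpa : p = ∑ i ∈ Finset.Icc 1 (r + 1),
      LaurentPolynomial.C (a i) * LaurentPolynomial.T (i : ℤ))
    (ha : a 1 ≠ 0) {Q : ℤ → ℤ → ℂ}
    (hQinit : ∀ m i : ℤ, 1 ≤ m → m ≤ (r : ℤ) → -(r : ℤ) ≤ i → i ≤ -1 →
      Q m i = if m = -i then 1 else 0)
    (hQrec : ∀ m : ℤ, (r : ℤ) + 1 ≤ m → ∀ i : ℤ,
      ((2 * m - 3 : ℤ) : ℂ) * a 1 * Q m i
        = ∑ j ∈ Finset.Icc 2 (r + 1),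
            ((3 * (j : ℤ) - 2 * m : ℤ) : ℂ) * a j * Q (m - j + 1) i)
    (m : ℤ) (hm : 1 ≤ m) :
    clsU p (-m) = ∑ k ∈ Finset.Icc 1 r, Q m (-(k : ℤ)) • om p k := by
  induction m using Int.strongRec (m := (r : ℤ) + 1) with
  | lt m hmr =>
    rw [Finset.sum_eq_single_of_mem m.natAbs (by simp; omega)]
    · rw [hQinit _ _ hm (by omega) (by omega) (by omega), if_pos (by omega), one_smul,
        om_eq_clsU p (by omega)]
      congr 1
      omega
    · intro k hk hne
      rw [Finset.mem_Icc] at hk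
      rw [hQinit _ _ hm (by omega) (by omega) (by omega), if_neg (by omega), zero_smul]
  | ge m hmr ih =>
    have hc : ((2 * m - 3 : ℤ) : ℂ) * a 1 ≠ 0 := by
      refine mul_ne_zero ?_ ha
      rw [Int.cast_ne_zero]; omega
    refine smul_right_injective _ hc ?_
    dsimp only
    have h := sum_smul_clsU_eq_zero hpa (-m)
    rw [← Finset.add_sum_Ioc_eq_sum_Icc (by omega), ← eq_neg_iff_add_eq_zero,
      show -m + (1 : ℕ) - 1 = -m by push_cast; ring,
      show 2 * -m + 3 * ((1 : ℕ) : ℤ) = -(2 * m - 3) by push_cast; ring, Int.cast_neg, neg_mul,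
      neg_smul, neg_inj, ← Finset.Icc_add_one_left_eq_Ioc] at h
    simp_rw [h, Finset.smul_sum, smul_smul, hQrec m hmr, Finset.sum_smul]
    rw [Finset.sum_comm]
    refine Finset.sum_congr rfl fun k hk => ?_
    rw [Finset.mem_Icc] at hk
    rw [show -m + k - 1 = -(m - k + 1) by ring, ih _ (by omega) (by omega), Finset.smul_sum]
    refine Finset.sum_congr rfl fun l _ => ?_
    rw [smul_smul, show 2 * -m + 3 * (k : ℤ) = 3 * k - 2 * m by ring]

end Recursions

section Bracket

open TensorProduct

variable (p : LaurentPolynomial ℂ) (L : Type) [LieRing L] [LieAlgebra ℂ L]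

/-- The bracket `[x ⊗ f, y ⊗ g] = [x, y] ⊗ f g` on the current algebra `L ⊗ R`. -/
def currentBracket : L ⊗[ℂ] HypRing p →ₗ[ℂ] L ⊗[ℂ] HypRing p →ₗ[ℂ] L ⊗[ℂ] HypRing p :=
  TensorProduct.map₂ (LieModule.toEnd ℂ L L : L →ₗ[ℂ] L →ₗ[ℂ] L) (LinearMap.mul ℂ (HypRing p))

/-- The cocycle `(x ⊗ f, y ⊗ g) ↦ (x, y) \overline{f dg}` on the current algebra `L ⊗ R`. -/
def currentCocycle : L ⊗[ℂ] HypRing p →ₗ[ℂ] L ⊗[ℂ] HypRing p →ₗ[ℂ] HypCenter p :=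
  (TensorProduct.map₂ (killingForm ℂ L) (clsBilin p)).compr₂
    (TensorProduct.lid ℂ (HypCenter p)).toLinearMap

/-- The bracket on `(L ⊗ R) ⊕ Ω_R/dR`. -/
def extensionBracket :
    (L ⊗[ℂ] HypRing p × HypCenter p) →ₗ[ℂ] (L ⊗[ℂ] HypRing p × HypCenter p) →ₗ[ℂ]
      (L ⊗[ℂ] HypRing p × HypCenter p) :=
  ((currentBracket p L).compr₂ (LinearMap.inl ℂ _ _) +
    (currentCocycle p L).compr₂ (LinearMap.inr ℂ _ _)).compl₁₂
      (LinearMap.fst ℂ _ _) (LinearMap.fst ℂ _ _)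

variable {L}

theorem currentBracket_tmul (x y : L) (f g : HypRing p) :
    currentBracket p L (x ⊗ₜ f) (y ⊗ₜ g) = ⁅x, y⁆ ⊗ₜ[ℂ] (f * g) := rfl

theorem currentCocycle_tmul (x y : L) (f g : HypRing p) :
    currentCocycle p L (x ⊗ₜ f) (y ⊗ₜ g) = killingForm ℂ L x y • cls p f g := rfl

theorem extensionBracket_apply (z w : L ⊗[ℂ] HypRing p × HypCenter p) :
    extensionBracket p L z w = (currentBracket p L z.1 w.1, currentCocycle p L z.1 w.1) := by
  simp [extensionBracket]

theorem currentBracket_add_swap (z w : L ⊗[ℂ] HypRing p) :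
    currentBracket p L z w + currentBracket p L w z = 0 := by
  induction z with
  | zero => simp
  | add z z' h h' =>
    simp only [map_add, LinearMap.add_apply]
    rw [add_add_add_comm, h, h', add_zero]
  | tmul x f =>
    induction w with
    | zero => simp
    | add w w' h h' =>
      simp only [map_add, LinearMap.add_apply]
      rw [add_add_add_comm, h, h', add_zero]
    | tmul y g =>
      rw [currentBracket_tmul, currentBracket_tmul, ← lie_skew x y, mul_comm g f,
        TensorProduct.neg_tmul, neg_add_cancel]

theorem currentCocycle_add_swap (z w : L ⊗[ℂ] HypRing p) :
    currentCocycle p L z w + currentCocycle p L w z = 0 := by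
  induction z with
  | zero => simp
  | add z z' h h' =>
    simp only [map_add, LinearMap.add_apply]
    rw [add_add_add_comm, h, h', add_zero]
  | tmul x f =>
    induction w with
    | zero => simp
    | add w w' h h' =>
      simp only [map_add, LinearMap.add_apply]
      rw [add_add_add_comm, h, h', add_zero]
    | tmul y g =>
      rw [currentCocycle_tmul, currentCocycle_tmul, killingForm, LieModule.traceForm_comm ℂ L L y x,
        ← smul_add, cls_add_cls_swap, smul_zero]

theorem extensionBracket_self (z : L ⊗[ℂ] HypRing p × HypCenter p) :
    extensionBracket p L z z = 0 := by
  rw [extensionBracket_apply, Prod.mk_eq_zero]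
  have h₁ := currentBracket_add_swap p z.1 z.1
  have h₂ := currentCocycle_add_swap p z.1 z.1
  rw [← two_smul ℂ] at h₁ h₂
  exact ⟨(smul_eq_zero.1 h₁).resolve_left two_ne_zero,
    (smul_eq_zero.1 h₂).resolve_left two_ne_zero⟩

theorem cyclic_sum_eq_zero {M : Type*} [AddCommGroup M] [Module ℂ M]
    (F : L ⊗[ℂ] HypRing p →ₗ[ℂ] L ⊗[ℂ] HypRing p →ₗ[ℂ] L ⊗[ℂ] HypRing p →ₗ[ℂ] M)
    (hF : ∀ (x y z : L) (f g h : HypRing p),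
      F (x ⊗ₜ f) (y ⊗ₜ g) (z ⊗ₜ h) + F (y ⊗ₜ g) (z ⊗ₜ h) (x ⊗ₜ f) +
        F (z ⊗ₜ h) (x ⊗ₜ f) (y ⊗ₜ g) = 0)
    (u v w : L ⊗[ℂ] HypRing p) :
    F u v w + F v w u + F w u v = 0 := by
  have sum_add (a b c a' b' c' : M) (h : a + b + c = 0) (h' : a' + b' + c' = 0) :
      a + a' + (b + b') + (c + c') = 0 := by
    rw [add_add_add_comm a a' b b', add_add_add_comm, h, h', add_zero]
  induction u with
  | zero => simp
  | add u u' h h' =>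
    simp only [map_add, LinearMap.add_apply]
    exact sum_add _ _ _ _ _ _ h h'
  | tmul x f =>
    induction v with
    | zero => simp
    | add v v' h h' =>
      simp only [map_add, LinearMap.add_apply]
      exact sum_add _ _ _ _ _ _ h h'
    | tmul y g =>
      induction w with
      | zero => simp
      | add w w' h h' =>
        simp only [map_add, LinearMap.add_apply]
        exact sum_add _ _ _ _ _ _ h h'
      | tmul z h => exact hF x y z f g h

theorem currentBracket_jacobi (u v w : L ⊗[ℂ] HypRing p) :
    currentBracket p L (currentBracket p L u v) w +
      currentBracket p L (currentBracket p L v w) u +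
      currentBracket p L (currentBracket p L w u) v = 0 := by
  refine cyclic_sum_eq_zero p ((currentBracket p L).compr₂ (currentBracket p L)) ?_ u v w
  intro x y z f g h
  simp only [LinearMap.compr₂_apply, currentBracket_tmul]
  rw [show g * h * f = f * g * h by ring, show h * f * g = f * g * h by ring,
    ← TensorProduct.add_tmul, ← TensorProduct.add_tmul]
  have hj : ⁅⁅x, y⁆, z⁆ + ⁅⁅y, z⁆, x⁆ + ⁅⁅z, x⁆, y⁆ = 0 := by
    rw [← lie_skew ⁅x, y⁆ z, ← lie_skew ⁅y, z⁆ x, ← lie_skew ⁅z, x⁆ y, ← neg_add, ← neg_add,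
      neg_eq_zero, ← lie_jacobi x y z]
    abel
  rw [hj, TensorProduct.zero_tmul]

theorem currentCocycle_cyclic (u v w : L ⊗[ℂ] HypRing p) :
    currentCocycle p L (currentBracket p L u v) w +
      currentCocycle p L (currentBracket p L v w) u +
      currentCocycle p L (currentBracket p L w u) v = 0 := by
  refine cyclic_sum_eq_zero p ((currentBracket p L).compr₂ (currentCocycle p L)) ?_ u v w
  intro x y z f g h
  simp only [LinearMap.compr₂_apply, currentBracket_tmul, currentCocycle_tmul]
  have h₁ : killingForm ℂ L ⁅y, z⁆ x = killingForm ℂ L ⁅x, y⁆ z := by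
    rw [killingForm, LieModule.traceForm_comm, LieModule.traceForm_apply_lie_apply]
  have h₂ : killingForm ℂ L ⁅z, x⁆ y = killingForm ℂ L ⁅x, y⁆ z := by
    rw [killingForm, LieModule.traceForm_apply_lie_apply, LieModule.traceForm_comm]
  rw [h₁, h₂, ← smul_add, ← smul_add, cls_mul_cyclic, smul_zero]

end Bracket

open TensorProduct in
/-- The universal central extension `ĝ = (𝔤 ⊗ R) ⊕ Ω_R/dR` carries a Lie bracket given by
`[x⊗f + ω, y⊗g + ω'] = [x,y]⊗fg + (x,y) \overline{f dg}`, with the explicit formulas of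
Theorem `mainresult` on the elements `x ⊗ t^i`, `x ⊗ t^i u`. -/
theorem universal_central_extension (r : ℕ) (hr : 1 ≤ r)
    (α : Fin r → ℂ) (hα0 : ∀ i, α i ≠ 0) (hαinj : Function.Injective α)
    (a : ℕ → ℂ) (p : LaurentPolynomial ℂ)
    (hp : p = LaurentPolynomial.T 1 *
      ∏ i : Fin r, (LaurentPolynomial.T 1 - LaurentPolynomial.C (α i)))
    (hpa : p = ∑ i ∈ Finset.Icc 1 (r + 1),
      LaurentPolynomial.C (a i) * LaurentPolynomial.T (i : ℤ))
    (P : ℤ → ℤ → ℂ)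
    (hPinit : ∀ l i : ℤ, -(r : ℤ) ≤ l → l ≤ -1 → -(r : ℤ) ≤ i → i ≤ -1 →
      P l i = if l = i then 1 else 0)
    (hPrec : ∀ k : ℤ, 0 ≤ k → ∀ i : ℤ,
      ((2 * k + (r : ℤ) + 3 : ℤ) : ℂ) * P k i
        = -∑ j ∈ Finset.Icc 1 r,
            ((3 * (j : ℤ) + 2 * k - 2 * (r : ℤ) : ℤ) : ℂ) * a j * P (k - r + j - 1) i)
    (Q : ℤ → ℤ → ℂ)
    (hQinit : ∀ m i : ℤ, 1 ≤ m → m ≤ (r : ℤ) → -(r : ℤ) ≤ i → i ≤ -1 →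
      Q m i = if m = -i then 1 else 0)
    (hQrec : ∀ m : ℤ, (r : ℤ) + 1 ≤ m → ∀ i : ℤ,
      ((2 * m - 3 : ℤ) : ℂ) * a 1 * Q m i
        = ∑ j ∈ Finset.Icc 2 (r + 1),
            ((3 * (j : ℤ) - 2 * m : ℤ) : ℂ) * a j * Q (m - j + 1) i)
    (L : Type) [LieRing L] [LieAlgebra ℂ L] [FiniteDimensional ℂ L]
    [LieAlgebra.IsSimple ℂ L] :
    ∃ B : (TensorProduct ℂ L (HypRing p) × HypCenter p) →ₗ[ℂ]
          (TensorProduct ℂ L (HypRing p) × HypCenter p) →ₗ[ℂ]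
          (TensorProduct ℂ L (HypRing p) × HypCenter p),
      -- `B` is alternating (hence antisymmetric) …
      (∀ z, B z z = 0) ∧
      -- … and satisfies the Jacobi identity, so `ĝ` is a Lie algebra;
      (∀ z₁ z₂ z₃, B (B z₁ z₂) z₃ + B (B z₂ z₃) z₁ + B (B z₃ z₁) z₂ = 0) ∧
      -- the defining formula `[x⊗f + ω, y⊗g + ω'] = [x,y]⊗fg + (x,y)\overline{f dg}`:
      (∀ (x y : L) (f g : HypRing p) (w w' : HypCenter p),
        B (x ⊗ₜ[ℂ] f, w) (y ⊗ₜ[ℂ] g, w')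
          = (⁅x, y⁆ ⊗ₜ[ℂ] (f * g), killingForm ℂ L x y • cls p f g)) ∧
      -- `[x⊗t^i, y⊗t^j] = [x,y]⊗t^{i+j} + j δ_{i+j,0} (x,y) ω₀`:
      (∀ (x y : L) (i j : ℤ),
        B (x ⊗ₜ[ℂ] tP p i, 0) (y ⊗ₜ[ℂ] tP p j, 0)
          = (⁅x, y⁆ ⊗ₜ[ℂ] tP p (i + j),
             ((if i + j = 0 then (j : ℂ) else 0) * killingForm ℂ L x y) • om p 0)) ∧
      -- `[x⊗t^i u, y⊗t^j u] = [x,y]⊗t^{i+j}p(t) + Σ_k (j+k/2) a_k δ_{i+j,−k} (x,y) ω₀`: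
      (∀ (x y : L) (i j : ℤ),
        B (x ⊗ₜ[ℂ] (tP p i * uE p), 0) (y ⊗ₜ[ℂ] (tP p j * uE p), 0)
          = (⁅x, y⁆ ⊗ₜ[ℂ] (tP p (i + j) * AdjoinRoot.of _ p),
             ((∑ k ∈ Finset.Icc 1 (r + 1),
                 if i + j = -(k : ℤ) then ((j : ℂ) + (k : ℂ) / 2) * a k else 0)
               * killingForm ℂ L x y) • om p 0)) ∧
      -- `[x⊗t^i u, y⊗t^j] = [x,y]⊗t^{i+j}u + j (x,y) ψ_{ij}`:
      (∀ (x y : L) (i j : ℤ),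
        B (x ⊗ₜ[ℂ] (tP p i * uE p), 0) (y ⊗ₜ[ℂ] tP p j, 0)
          = (⁅x, y⁆ ⊗ₜ[ℂ] (tP p (i + j) * uE p),
             ((j : ℂ) * killingForm ℂ L x y) •
               (if -(r : ℤ) + 1 ≤ i + j
                then ∑ k ∈ Finset.Icc 1 r, P (i + j - 1) (-(k : ℤ)) • om p k
                else ∑ k ∈ Finset.Icc 1 r, Q (-i - j + 1) (-(k : ℤ)) • om p k))) := by
  have ha_top := leading_eq_one (hp.symm.trans hpa)
  have ha_one := linear_coeff_ne_zero hα0 (hp.symm.trans hpa)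
  have hB (x y : L) (f g : HypRing p) (w w' : HypCenter p) :
      extensionBracket p L (x ⊗ₜ[ℂ] f, w) (y ⊗ₜ[ℂ] g, w')
        = (⁅x, y⁆ ⊗ₜ[ℂ] (f * g), killingForm ℂ L x y • cls p f g) :=
    extensionBracket_apply p _ _
  refine ⟨extensionBracket p L, extensionBracket_self p, fun z₁ z₂ z₃ => ?_, hB,
    fun x y i j => ?_, fun x y i j => ?_, fun x y i j => ?_⟩
  · simp only [extensionBracket_apply, Prod.mk_add_mk]
    rw [currentBracket_jacobi, currentCocycle_cyclic, Prod.mk_zero_zero]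
  · rw [hB, ← tP_add, cls_tP_tP, smul_smul, mul_comm]
  · rw [hB, cls_tP_mul_uE_tP_mul_uE hpa, smul_smul, mul_comm (killingForm ℂ L x y),
      mul_mul_mul_comm, ← tP_add, uE_mul_uE]
  · rw [hB, mul_right_comm, ← tP_add, cls_tP_mul_uE_tP, smul_smul, mul_comm (killingForm ℂ L x y)]
    congr 2
    split_ifs with h
    · exact clsU_eq_sum_P hpa ha_top hPinit hPrec _ (by omega)
    · rw [← clsU_eq_sum_Q hpa ha_one hQinit hQrec _ (by omega)]
      congr 1
      ring

end
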